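/- arXiv:1801.09976 — 4 statements merged into one kernel-verified Lean document; each statement's English description precedes it below -/
import Mathlib

section
/- Let A be a Noetherian commutative ring, X = Spec A its prime spectrum, and g ∈ A[x_1, …, x_n] a polynomial of total degree d. Then there is a Zariski closed subset Z ⊆ X with the following property: a prime ideal 𝔭 ∈ X lies in Z if and only if there exists an algebraically closed field extension k of the residue field κ(𝔭) such that the image of g in k[x_1, …, x_n] is reducible or has total degree strictly less than d. -/
universe u

/-- A multivariate polynomial is reducible if it is a product of two non-units. -/
def MvPolyReducible {σ : Type*} {R : Type*} [CommRing R] (g : MvPolynomial σ R) : Prop :=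
  ∃ a b : MvPolynomial σ R, g = a * b ∧ ¬IsUnit a ∧ ¬IsUnit b

namespace MvPolynomial

variable {σ : Type*}

lemma totalDegree_le_iff_coeff {R : Type*} [CommSemiring R] {p : MvPolynomial σ R} {i : ℕ} :
    p.totalDegree ≤ i ↔ ∀ m, p.coeff m ≠ 0 → m.degree ≤ i := by
  simp only [totalDegree, Finset.sup_le_iff, mem_support_iff, Finsupp.degree_apply]
  rfl

lemma totalDegree_map_le_of_le {R S : Type*} [CommSemiring R] [CommSemiring S] (f : R →+* S)
    {p : MvPolynomial σ R} {i : ℕ} (h : p.totalDegree ≤ i) : (map f p).totalDegree ≤ i := by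
  rw [totalDegree_le_iff_coeff] at h ⊢
  intro m hm
  refine h m fun h0 ↦ hm ?_
  rw [coeff_map, h0, map_zero]

lemma totalDegree_le_of_map_le {R S : Type*} [CommSemiring R] [CommSemiring S] {f : R →+* S}
    (hf : Function.Injective f) {p : MvPolynomial σ R} {i : ℕ}
    (h : (map f p).totalDegree ≤ i) : p.totalDegree ≤ i := by
  rw [totalDegree_le_iff_coeff] at h ⊢
  intro m hm
  refine h m ?_
  rw [coeff_map]
  exact fun h0 ↦ hm (hf (h0.trans (map_zero f).symm))

/-- For positive `d`, the total degree of a polynomial of degree at most `d` drops if and only if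
all its coefficients of degree `d` vanish. -/
lemma totalDegree_lt_iff_coeff {R : Type*} [CommSemiring R] {p : MvPolynomial σ R} {d : ℕ}
    (hd : 0 < d) (h : p.totalDegree ≤ d) :
    p.totalDegree < d ↔ ∀ m, m.degree = d → p.coeff m = 0 := by
  rw [← Nat.le_sub_one_iff_lt hd, totalDegree_le_iff_coeff]
  rw [totalDegree_le_iff_coeff] at h
  refine ⟨fun H m hm ↦ ?_, fun H m hm ↦ ?_⟩
  · by_contra h0
    have := H m h0
    omega
  · have h1 := h m hm
    have h2 : m.degree ≠ d := fun h2 ↦ hm (H m h2)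
    omega

/-- `p` is a product of polynomials of total degree at most `i` and at most `j`. -/
def FactorsWithDegreeLE {R : Type*} [CommSemiring R] (p : MvPolynomial σ R) (i j : ℕ) : Prop :=
  ∃ a b : MvPolynomial σ R, p = a * b ∧ a.totalDegree ≤ i ∧ b.totalDegree ≤ j

lemma FactorsWithDegreeLE.map {R S : Type*} [CommSemiring R] [CommSemiring S] (f : R →+* S)
    {p : MvPolynomial σ R} {i j : ℕ} (h : p.FactorsWithDegreeLE i j) :
    (map f p).FactorsWithDegreeLE i j := by
  obtain ⟨a, b, rfl, ha, hb⟩ := h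
  exact ⟨_, _, map_mul _ a b, totalDegree_map_le_of_le f ha, totalDegree_map_le_of_le f hb⟩

/-- The coefficients of `p` in degree `d` vanish, or `p` is a product of two polynomials whose
degrees are bounded by positive integers with sum `d`. -/
def Degenerates {R : Type*} [CommSemiring R] (p : MvPolynomial σ R) (d : ℕ) : Prop :=
  (∀ m, m.degree = d → p.coeff m = 0) ∨
    ∃ i j, 0 < i ∧ 0 < j ∧ i + j = d ∧ p.FactorsWithDegreeLE i j

lemma Degenerates.map {R S : Type*} [CommSemiring R] [CommSemiring S] (f : R →+* S)
    {p : MvPolynomial σ R} {d : ℕ} (h : p.Degenerates d) : (map f p).Degenerates d := by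
  obtain h | ⟨i, j, hi, hj, hij, h⟩ := h
  · left
    intro m hm
    rw [coeff_map, h m hm, map_zero]
  · exact .inr ⟨i, j, hi, hj, hij, h.map f⟩

lemma degenerates_iff {k : Type*} [Field k] {p : MvPolynomial σ k} {d : ℕ} (hd : 0 < d)
    (hp : p.totalDegree ≤ d) :
    p.Degenerates d ↔ MvPolyReducible p ∨ p.totalDegree < d := by
  rw [Degenerates, ← totalDegree_lt_iff_coeff hd hp, or_comm]
  refine or_congr_left' fun hlt ↦ ?_
  have hdeg : p.totalDegree = d := by omega
  have hp0 : p ≠ 0 := by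
    rintro rfl
    rw [totalDegree_zero] at hdeg
    omega
  refine ⟨?_, ?_⟩
  · rintro ⟨i, j, hi, hj, hij, a, b, rfl, ha, hb⟩
    rw [totalDegree_mul_of_isDomain (left_ne_zero_of_mul hp0) (right_ne_zero_of_mul hp0)] at hdeg
    refine ⟨a, b, rfl, fun h ↦ ?_, fun h ↦ ?_⟩ <;>
    · have := (isUnit_iff_totalDegree_of_isReduced.mp h).2
      omega
  · rintro ⟨a, b, rfl, ha, hb⟩
    have ha0 := left_ne_zero_of_mul hp0
    have hb0 := right_ne_zero_of_mul hp0
    rw [totalDegree_mul_of_isDomain ha0 hb0] at hdeg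
    have pos {c : MvPolynomial σ k} (hc0 : c ≠ 0) (hc : ¬IsUnit c) : 0 < c.totalDegree := by
      rw [Nat.pos_iff_ne_zero]
      intro h
      rw [totalDegree_eq_zero_iff_eq_C] at h
      refine hc ?_
      rw [h] at hc0 ⊢
      exact (isUnit_iff_ne_zero.mpr fun h0 ↦ hc0 (by rw [h0, C_0])).map C
    exact ⟨_, _, pos ha0 ha, pos hb0 hb, hdeg, a, b, rfl, le_rfl, le_rfl⟩

/-- A nonzero polynomial over the field of a valuation subring is a multiple of a primitive one. -/
lemma exists_eq_C_mul_map_of_valuationSubring {K : Type*} [Field K] (V : ValuationSubring K)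
    {a : MvPolynomial σ K} (ha : a ≠ 0) :
    ∃ (c : K) (a' : MvPolynomial σ V), a = C c * map V.subtype a' ∧ c ≠ 0 ∧
      map (IsLocalRing.residue V) a' ≠ 0 := by
  obtain ⟨m, hm, hmax⟩ := a.support.exists_max_image (fun m ↦ V.valuation (a.coeff m))
    (support_nonempty.mpr ha)
  have hc : a.coeff m ≠ 0 := mem_support_iff.mp hm
  obtain ⟨a', ha'⟩ : ∃ a' : MvPolynomial σ V, map V.subtype a' = C (a.coeff m)⁻¹ * a := by
    change _ ∈ Set.range _
    rw [mem_range_map_iff_coeffs_subset]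
    intro x hx
    obtain ⟨l, hl, rfl⟩ := mem_coeffs_iff.mp hx
    have hle : V.valuation ((a.coeff m)⁻¹ * a.coeff l) ≤ 1 := by
      rw [map_mul, map_inv₀, inv_mul_le_one₀ (by simpa [zero_lt_iff] using hc)]
      by_cases h0 : a.coeff l = 0
      · simp [h0]
      · exact hmax l (mem_support_iff.mpr h0)
    rw [coeff_C_mul]
    exact ⟨⟨_, (V.valuation_le_one_iff _).mp hle⟩, rfl⟩
  refine ⟨a.coeff m, a', ?_, hc, fun h ↦ ?_⟩
  · rw [ha', ← mul_assoc, ← C_mul, mul_inv_cancel₀ hc, C_1, one_mul]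
  · have h1 : a'.coeff m = 1 := by
      apply V.subtype_injective
      rw [← coeff_map, ha', coeff_C_mul, inv_mul_cancel₀ hc, map_one]
    have h2 := congrArg (coeff m) h
    rw [coeff_map, h1, map_one, coeff_zero] at h2
    exact one_ne_zero h2

/-- The Gauss lemma: factorizations descend to valuation subrings. -/
lemma FactorsWithDegreeLE.of_map_valuationSubring {K : Type*} [Field K] (V : ValuationSubring K)
    {p : MvPolynomial σ V} (hp : p ≠ 0) {i j : ℕ}
    (h : (MvPolynomial.map V.subtype p).FactorsWithDegreeLE i j) :
    p.FactorsWithDegreeLE i j := by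
  obtain ⟨a, b, hab, ha, hb⟩ := h
  have hinj := map_injective (σ := σ) _ V.subtype_injective
  have hab0 : a * b ≠ 0 := by
    rw [← hab]
    exact fun h ↦ hp (hinj (h.trans (map_zero _).symm))
  obtain ⟨c, a', rfl, hc, ha'⟩ :=
    exists_eq_C_mul_map_of_valuationSubring V (left_ne_zero_of_mul hab0)
  obtain ⟨e, b', rfl, he, hb'⟩ :=
    exists_eq_C_mul_map_of_valuationSubring V (right_ne_zero_of_mul hab0)
  have heq : MvPolynomial.map V.subtype p = C (c * e) * MvPolynomial.map V.subtype (a' * b') := by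
    rw [hab, map_mul, map_mul]
    ring
  obtain ⟨m, hm⟩ := ne_zero_iff.mp (mul_ne_zero ha' hb')
  rw [← map_mul, coeff_map, ne_eq, IsLocalRing.residue_eq_zero_iff,
    IsLocalRing.mem_maximalIdeal, mem_nonunits_iff, not_not] at hm
  obtain ⟨u, hu⟩ := hm
  obtain ⟨r, hr⟩ : ∃ r : V, V.subtype r = c * e := by
    refine ⟨p.coeff m * ↑u⁻¹, ?_⟩
    have h1 := congrArg (coeff m) heq
    rw [coeff_map, coeff_C_mul, coeff_map, ← hu] at h1
    rw [map_mul, h1, mul_assoc, ← map_mul, Units.mul_inv, map_one, mul_one]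
  have hdeg {c : K} (hc : c ≠ 0) {q : MvPolynomial σ V} {i : ℕ}
      (h : (C c * MvPolynomial.map V.subtype q).totalDegree ≤ i) : q.totalDegree ≤ i := by
    apply totalDegree_le_of_map_le V.subtype_injective
    rw [totalDegree_le_iff_coeff] at h ⊢
    intro m hm
    apply h
    rw [coeff_C_mul]
    exact mul_ne_zero hc hm
  refine ⟨C r * a', b', hinj ?_, ?_, hdeg he hb⟩
  · rw [heq, mul_assoc, map_mul _ (C r), map_C, hr]
  · refine (totalDegree_mul _ _).trans ?_
    rw [totalDegree_C, zero_add]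
    exact hdeg hc ha

/-- The polynomial of degree at most `i` whose coefficients are the variables `X (t, m)`. -/
noncomputable def genericPoly (A : Type*) [CommRing A] {τ : Type*} [Finite σ] (t : τ) (i : ℕ) :
    MvPolynomial σ (MvPolynomial (τ × (σ →₀ ℕ)) A) :=
  ∑ m ∈ (Finsupp.finite_of_degree_le (σ := σ) i).toFinset, monomial m (X (t, m))

section genericPoly

variable {A : Type*} [CommRing A] {τ : Type*} [Finite σ]

lemma totalDegree_genericPoly_le (t : τ) (i : ℕ) :
    (genericPoly (σ := σ) A t i).totalDegree ≤ i := by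
  refine totalDegree_finsetSum_le fun m hm ↦ ?_
  refine (totalDegree_monomial_le _ _).trans ?_
  simpa [Finsupp.degree_apply, Finsupp.sum] using hm

lemma map_genericPoly {k : Type*} [CommRing k] (φ : A →+* k) (a : τ → MvPolynomial σ k) (t : τ)
    {i : ℕ} (h : (a t).totalDegree ≤ i) :
    map (eval₂Hom φ fun x ↦ (a x.1).coeff x.2) (genericPoly A t i) = a t := by
  classical
  rw [totalDegree_le_iff_coeff] at h
  ext m
  simp only [genericPoly, map_sum, map_monomial, coeff_sum, coeff_monomial, coe_eval₂Hom,
    eval₂_X, Finset.sum_ite_eq', Set.Finite.mem_toFinset, Set.mem_ofPred_eq]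
  split_ifs with hm
  · rfl
  · by_contra h0
    exact hm (h m (Ne.symm h0))

end genericPoly

section Locus

variable {σ : Type} {A : Type u} [CommRing A]

/-- Points at which the degree of `g` drops, or the two generic polynomials of degrees `i` and `j`
specialize to a factorization of `g` for some positive `i` and `j` with sum `d`. -/
def factorizationSpace [Finite σ] (g : MvPolynomial σ A) (d : ℕ) :
    Set (PrimeSpectrum (MvPolynomial (Bool × (σ →₀ ℕ)) A)) :=
  PrimeSpectrum.zeroLocus ((fun m ↦ C (g.coeff m)) '' {m | m.degree = d}) ∪
    ⋃ x ∈ {x : ℕ × ℕ | 0 < x.1 ∧ 0 < x.2 ∧ x.1 + x.2 = d},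
      PrimeSpectrum.zeroLocus (Set.range fun m ↦
        (map C g - genericPoly A true x.1 * genericPoly A false x.2).coeff m)

lemma isClosed_factorizationSpace [Finite σ] (g : MvPolynomial σ A) (d : ℕ) :
    IsClosed (factorizationSpace g d) := by
  refine (PrimeSpectrum.isClosed_zeroLocus _).union (Set.Finite.isClosed_biUnion ?_ fun x _ ↦
    PrimeSpectrum.isClosed_zeroLocus _)
  exact (Set.finite_Iic (d, d)).subset fun x hx ↦ Prod.mk_le_mk.mpr (by grind)

lemma mem_image_factorizationSpace_iff [Finite σ] {g : MvPolynomial σ A} {d : ℕ} {p : PrimeSpectrum A} :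
    p ∈ PrimeSpectrum.comap C '' factorizationSpace g d ↔
      ∃ (k : Type u) (_ : Field k) (φ : A →+* k),
        RingHom.ker φ = p.asIdeal ∧ (map φ g).Degenerates d := by
  constructor
  · rintro ⟨P, hP, rfl⟩
    let ψ : MvPolynomial (Bool × (σ →₀ ℕ)) A →+* P.asIdeal.ResidueField := algebraMap _ _
    have hψ (x) : ψ x = 0 ↔ x ∈ P.asIdeal := Ideal.algebraMap_residueField_eq_zero
    refine ⟨P.asIdeal.ResidueField, inferInstance, ψ.comp C, ?_, ?_⟩
    · ext x
      exact hψ (C x)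
    rw [← map_map]
    obtain hP | hP := hP
    · left
      intro m hm
      rw [coeff_map, coeff_map, hψ]
      exact hP ⟨m, hm, rfl⟩
    · simp only [Set.mem_iUnion] at hP
      obtain ⟨⟨i, j⟩, ⟨hi, hj, hij⟩, hP⟩ := hP
      refine .inr ⟨i, j, hi, hj, hij, map ψ (genericPoly A true i),
        map ψ (genericPoly A false j), ?_,
        totalDegree_map_le_of_le _ (totalDegree_genericPoly_le _ _),
        totalDegree_map_le_of_le _ (totalDegree_genericPoly_le _ _)⟩
      rw [← map_mul, ← sub_eq_zero, ← map_sub]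
      ext m
      rw [coeff_map, coeff_zero, hψ]
      exact hP ⟨m, rfl⟩
  · rintro ⟨k, _, φ, hφ, h⟩
    obtain ⟨a, ha⟩ : ∃ a : Bool → MvPolynomial σ k, (∀ m, m.degree = d → (map φ g).coeff m = 0) ∨
        ∃ i j, 0 < i ∧ 0 < j ∧ i + j = d ∧ map φ g = a true * a false ∧
          (a true).totalDegree ≤ i ∧ (a false).totalDegree ≤ j := by
      obtain h | ⟨i, j, hi, hj, hij, a, b, hab⟩ := h
      · exact ⟨0, .inl h⟩
      · exact ⟨fun t ↦ if t then a else b, .inr ⟨i, j, hi, hj, hij, by simpa using hab⟩⟩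
    let ψ : MvPolynomial (Bool × (σ →₀ ℕ)) A →+* k := eval₂Hom φ fun x ↦ (a x.1).coeff x.2
    have hψ : ψ.comp C = φ := eval₂Hom_comp_C _ _
    refine ⟨⟨RingHom.ker ψ, RingHom.ker_isPrime ψ⟩, ?_, ?_⟩
    · obtain h | ⟨i, j, hi, hj, hij, hab, ha, hb⟩ := ha
      · left
        rintro _ ⟨m, hm, rfl⟩
        have := h m hm
        rw [coeff_map, ← hψ] at this
        exact this
      · right
        simp only [Set.mem_iUnion]
        refine ⟨(i, j), ⟨hi, hj, hij⟩, ?_⟩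
        rintro _ ⟨m, rfl⟩
        change ψ _ = 0
        rw [← coeff_map, map_sub, map_mul, map_genericPoly φ a true ha,
          map_genericPoly φ a false hb, map_map, hψ, hab, sub_self, coeff_zero]
    · ext x
      rw [← hφ]
      exact iff_of_eq (congrArg (· = 0) (RingHom.congr_fun hψ x))

lemma exists_valuationSubring_of_ker_le {k : Type*} [Field k] (φ : A →+* k) {q : Ideal A}
    [q.IsPrime] (h : RingHom.ker φ ≤ q) :
    ∃ (V : ValuationSubring k) (φ' : A →+* V), V.subtype.comp φ' = φ ∧
      RingHom.ker ((IsLocalRing.residue V).comp φ') = q := by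
  let φq : Localization.AtPrime q →+* k := IsLocalization.lift (M := q.primeCompl) (g := φ)
    fun y ↦ isUnit_iff_ne_zero.mpr fun h0 ↦ y.2 (h h0)
  obtain ⟨V, hV, hloc⟩ := IsLocalRing.exists_factor_valuationRing φq
  refine ⟨V, (φq.codRestrict V.toSubring hV).comp (algebraMap A _), ?_, ?_⟩
  · ext x
    exact IsLocalization.lift_eq _ x
  · ext x
    rw [RingHom.mem_ker, RingHom.comp_apply, IsLocalRing.residue_eq_zero_iff,
      IsLocalRing.mem_maximalIdeal, mem_nonunits_iff, RingHom.comp_apply]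
    erw [isUnit_map_iff]
    rw [IsLocalization.AtPrime.isUnit_to_map_iff (Localization.AtPrime q) q]
    simp [Ideal.primeCompl]

lemma stableUnderSpecialization_degenerates (g : MvPolynomial σ A) (d : ℕ) :
    StableUnderSpecialization {p : PrimeSpectrum A | ∃ (k : Type u) (_ : Field k) (φ : A →+* k),
      RingHom.ker φ = p.asIdeal ∧ (map φ g).Degenerates d} := by
  rintro p q hpq ⟨k, _, φ, hφ, h⟩
  rw [← PrimeSpectrum.le_iff_specializes, ← PrimeSpectrum.asIdeal_le_asIdeal, ← hφ] at hpq
  obtain ⟨V, φ', rfl, hq⟩ := exists_valuationSubring_of_ker_le φ hpq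
  refine ⟨IsLocalRing.ResidueField V, inferInstance, _, hq, ?_⟩
  rw [← map_map]
  rw [← map_map] at h
  apply Degenerates.map
  by_cases hg : map φ' g = 0
  · exact .inl fun m _ ↦ by rw [hg, coeff_zero]
  obtain h | ⟨i, j, hi, hj, hij, h⟩ := h
  · left
    intro m hm
    apply V.subtype_injective
    rw [← coeff_map, h m hm, map_zero]
  · exact .inr ⟨i, j, hi, hj, hij, h.of_map_valuationSubring V hg⟩

lemma isClosed_degenerates [Finite σ] (g : MvPolynomial σ A) (d : ℕ) :
    IsClosed {p : PrimeSpectrum A | ∃ (k : Type u) (_ : Field k) (φ : A →+* k),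
      RingHom.ker φ = p.asIdeal ∧ (map φ g).Degenerates d} := by
  have heq := Set.ext fun p : PrimeSpectrum A ↦ mem_image_factorizationSpace_iff (g := g) (d := d)
  have hs := stableUnderSpecialization_degenerates g d
  rw [← heq] at hs ⊢
  exact PrimeSpectrum.isClosed_image_of_stableUnderSpecialization _ _
    (isClosed_factorizationSpace g d) hs

end Locus

end MvPolynomial

/-- Homomorphisms to fields with kernel `p` yield algebraically closed extensions of `κ(p)`. -/
lemma PrimeSpectrum.exists_isAlgClosed_extension {A k : Type u} [CommRing A] [Field k]
    (p : PrimeSpectrum A) (φ : A →+* k) (h : RingHom.ker φ = p.asIdeal) :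
    ∃ (K : Type u) (_ : Field K) (_ : IsAlgClosed K)
      (_ : Algebra (FractionRing (A ⧸ p.asIdeal)) K) (f : k →+* K),
      (algebraMap (FractionRing (A ⧸ p.asIdeal)) K).comp
        ((algebraMap (A ⧸ p.asIdeal) (FractionRing (A ⧸ p.asIdeal))).comp
          (Ideal.Quotient.mk p.asIdeal)) = f.comp φ := by
  let φp : A ⧸ p.asIdeal →+* k := Ideal.Quotient.lift p.asIdeal φ fun x hx ↦ by
    rwa [← h] at hx
  have hφp : Function.Injective φp := RingHom.lift_injective_of_ker_le_ideal _ _ h.le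
  let f : k →+* AlgebraicClosure k := algebraMap _ _
  let F : FractionRing (A ⧸ p.asIdeal) →+* AlgebraicClosure k :=
    f.comp (IsFractionRing.lift hφp)
  refine ⟨AlgebraicClosure k, inferInstance, inferInstance, F.toAlgebra, f, ?_⟩
  have hF : F.comp (algebraMap (A ⧸ p.asIdeal) (FractionRing (A ⧸ p.asIdeal))) = f.comp φp :=
    RingHom.ext fun x ↦ congrArg f (IsFractionRing.lift_algebraMap hφp x)
  rw [RingHom.algebraMap_toAlgebra, ← RingHom.comp_assoc, hF, RingHom.comp_assoc]
  exact congrArg f.comp (Ideal.Quotient.lift_comp_mk ..)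

lemma PrimeSpectrum.ker_to_extension {A k : Type*} [CommRing A] [Field k]
    (p : PrimeSpectrum A) [Algebra (FractionRing (A ⧸ p.asIdeal)) k] :
    RingHom.ker ((algebraMap (FractionRing (A ⧸ p.asIdeal)) k).comp
      ((algebraMap (A ⧸ p.asIdeal) (FractionRing (A ⧸ p.asIdeal))).comp
        (Ideal.Quotient.mk p.asIdeal))) = p.asIdeal := by
  rw [RingHom.ker_comp_of_injective _ (RingHom.injective _),
    RingHom.ker_comp_of_injective _ (IsFractionRing.injective _ _), Ideal.mk_ker]

lemma mvPolyReducible_C_iff {σ k : Type*} [Field k] {c : k} :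
    MvPolyReducible (MvPolynomial.C (σ := σ) c) ↔ c = 0 := by
  refine ⟨?_, ?_⟩
  · rintro ⟨a, b, hab, ha, -⟩
    by_contra hc
    exact ha (isUnit_of_mul_isUnit_left (hab ▸ (isUnit_iff_ne_zero.mpr hc).map MvPolynomial.C))
  · rintro rfl
    exact ⟨0, 0, by simp, not_isUnit_zero, not_isUnit_zero⟩

/-- Osserman's proposition: for a Noetherian ring `A` and `g ∈ A[x₁,…,xₙ]` of total
degree `d`, there is a Zariski closed subset `Z ⊆ Spec A` such that a prime `𝔭` lies
in `Z` iff there is an algebraically closed extension `k` of the residue field `κ(𝔭)`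
over which `g` becomes reducible or drops total degree below `d`. -/
theorem osserman_closed_locus {A : Type u} [CommRing A] [IsNoetherianRing A]
    {n : ℕ} (g : MvPolynomial (Fin n) A) (d : ℕ) (hd : g.totalDegree = d) :
    ∃ Z : Set (PrimeSpectrum A), IsClosed Z ∧
      ∀ p : PrimeSpectrum A, p ∈ Z ↔
        ∃ (k : Type u) (_ : Field k) (_ : IsAlgClosed k)
          (_ : Algebra (FractionRing (A ⧸ p.asIdeal)) k),
          MvPolyReducible
              (MvPolynomial.map
                ((algebraMap (FractionRing (A ⧸ p.asIdeal)) k).comp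
                  ((algebraMap (A ⧸ p.asIdeal) (FractionRing (A ⧸ p.asIdeal))).comp
                    (Ideal.Quotient.mk p.asIdeal))) g) ∨
            (MvPolynomial.map
              ((algebraMap (FractionRing (A ⧸ p.asIdeal)) k).comp
                ((algebraMap (A ⧸ p.asIdeal) (FractionRing (A ⧸ p.asIdeal))).comp
                  (Ideal.Quotient.mk p.asIdeal))) g).totalDegree < d := by
  obtain rfl | hd0 := Nat.eq_zero_or_pos d
  · rw [MvPolynomial.totalDegree_eq_zero_iff_eq_C] at hd
    refine ⟨PrimeSpectrum.zeroLocus {g.coeff 0}, PrimeSpectrum.isClosed_zeroLocus _, fun p ↦ ?_⟩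
    rw [PrimeSpectrum.mem_zeroLocus, Set.singleton_subset_iff, SetLike.mem_coe, hd]
    simp only [MvPolynomial.map_C, mvPolyReducible_C_iff, not_lt_zero, or_false,
      MvPolynomial.coeff_C, if_true, ← RingHom.mem_ker, PrimeSpectrum.ker_to_extension]
    refine ⟨fun h ↦ ?_, fun ⟨_, _, _, _, h⟩ ↦ h⟩
    obtain ⟨K, hK, hK', hKp, -⟩ := p.exists_isAlgClosed_extension
      (algebraMap A p.asIdeal.ResidueField) (Ideal.ker_algebraMap_residueField _)
    exact ⟨K, hK, hK', hKp, h⟩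
  · refine ⟨_, g.isClosed_degenerates d, fun p ↦ ⟨?_, ?_⟩⟩
    · rintro ⟨k, _, φ, hφ, h⟩
      obtain ⟨K, hK, hK', hKp, f, hf⟩ := p.exists_isAlgClosed_extension φ hφ
      refine ⟨K, hK, hK', hKp, ?_⟩
      rw [← MvPolynomial.degenerates_iff hd0 (MvPolynomial.totalDegree_map_le_of_le _ hd.le), hf,
        ← MvPolynomial.map_map]
      exact h.map f
    · rintro ⟨K, _, _, _, h⟩
      rw [← MvPolynomial.degenerates_iff hd0
        (MvPolynomial.totalDegree_map_le_of_le _ hd.le)] at h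
      exact ⟨K, inferInstance, _, p.ker_to_extension, h⟩
end

section
/- Let A be a one-dimensional Noetherian local integral domain with maximal ideal 𝔪, and let g ∈ A[x_1, …, x_n] be a polynomial of total degree d. If g, considered as a polynomial in Q(A)[x_1, …, x_n], is reducible over some finite field extension of Q(A), then the reduction of g in (A/𝔪)[x_1, …, x_n] has total degree strictly smaller than d, or is reducible over some finite extension field of A/𝔪. -/
universe u

open MvPolynomial IsLocalRing

theorem MvPolynomial.totalDegree_map_le {σ R S : Type*} [CommSemiring R] [CommSemiring S]
    (f : R →+* S) (p : MvPolynomial σ R) : (map f p).totalDegree ≤ p.totalDegree :=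
  Finset.sup_mono (support_map_subset f p)

theorem MvPolynomial.totalDegree_map_of_injective {σ R S : Type*} [CommSemiring R]
    [CommSemiring S] {f : R →+* S} (hf : Function.Injective f) (p : MvPolynomial σ R) :
    (map f p).totalDegree = p.totalDegree := by
  rw [totalDegree, totalDegree, support_map_of_injective p hf]

theorem MvPolynomial.not_isUnit_iff_totalDegree_ne_zero {σ K : Type*} [Field K]
    {p : MvPolynomial σ K} (hp : p ≠ 0) : ¬IsUnit p ↔ p.totalDegree ≠ 0 := by
  refine not_congr ⟨fun h ↦ (isUnit_iff_totalDegree_of_isReduced.mp h).2, fun h ↦ ?_⟩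
  rw [totalDegree_eq_zero_iff_eq_C] at h
  rw [h] at hp ⊢
  exact (IsUnit.mk0 _ fun h0 ↦ hp (by rw [h0, C_0])).map C

/-- A nonzero polynomial over the fraction field of a valuation ring is a scalar multiple of
a polynomial over the valuation ring with nonzero reduction. -/
theorem ValuationSubring.exists_primitive_of_ne_zero {σ K : Type*} [Field K]
    (V : ValuationSubring K) {a : MvPolynomial σ K} (ha : a ≠ 0) :
    ∃ (c : K) (a' : MvPolynomial σ V), c ≠ 0 ∧ a = C c * map (algebraMap V K) a' ∧
      map (residue V) a' ≠ 0 := by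
  obtain ⟨m, hm, hmax⟩ := Finset.exists_max_image a.support (fun m ↦ V.valuation (a.coeff m))
    (support_nonempty.mpr ha)
  have hc : a.coeff m ≠ 0 := mem_support_iff.mp hm
  have hmem : C (a.coeff m)⁻¹ * a ∈ Set.range (map (algebraMap V K)) := by
    rw [mem_range_map_iff_coeffs_subset]
    intro x hx
    obtain ⟨k, hk, rfl⟩ := mem_coeffs_iff.mp hx
    have hk' : k ∈ a.support := by
      rw [mem_support_iff, coeff_C_mul] at hk
      exact mem_support_iff.mpr (right_ne_zero_of_mul hk)
    refine ⟨⟨_, (V.valuation_le_one_iff _).mp ?_⟩, rfl⟩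
    change V.valuation (coeff k (C _ * a)) ≤ 1
    rw [coeff_C_mul, map_mul, map_inv₀]
    exact inv_mul_le_one_of_le₀ (hmax k hk') zero_le
  obtain ⟨a', ha'⟩ := hmem
  refine ⟨a.coeff m, a', hc, ?_, fun h ↦ ?_⟩
  · rw [ha', ← mul_assoc, ← C_mul, mul_inv_cancel₀ hc, C_1, one_mul]
  · have h1 : a'.coeff m = 1 := by
      apply FaithfulSMul.algebraMap_injective V K
      rw [← coeff_map, ha', coeff_C_mul, inv_mul_cancel₀ hc, map_one]
    have h0 := congrArg (coeff m) h
    rw [coeff_map, h1, map_one, coeff_zero] at h0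
    exact one_ne_zero h0

/-- Gauss's lemma over a valuation ring: a factorization over the fraction field of a polynomial
with nonzero reduction comes from a factorization over the valuation ring. -/
theorem ValuationSubring.exists_factorization {σ K : Type*} [Field K]
    (V : ValuationSubring K) {g : MvPolynomial σ V} (hg : map (residue V) g ≠ 0)
    {a b : MvPolynomial σ K} (hab : map (algebraMap V K) g = a * b) :
    ∃ a' b' : MvPolynomial σ V, g = a' * b' ∧ a'.totalDegree = a.totalDegree ∧
      b'.totalDegree = b.totalDegree := by
  have hinj : Function.Injective (algebraMap V K) := FaithfulSMul.algebraMap_injective V K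
  have hg0 : map (algebraMap V K) g ≠ 0 := by
    rw [map_ne_zero_iff _ (map_injective _ hinj)]
    rintro rfl
    exact hg (map_zero _)
  obtain ⟨c, a', hc, rfl, ha'⟩ := V.exists_primitive_of_ne_zero (left_ne_zero_of_mul (hab ▸ hg0))
  obtain ⟨e, b', he, rfl, hb'⟩ := V.exists_primitive_of_ne_zero (right_ne_zero_of_mul (hab ▸ hg0))
  obtain ⟨m, hm⟩ := ne_zero_iff.mp (mul_ne_zero ha' hb')
  rw [← map_mul, coeff_map, residue_ne_zero_iff_isUnit] at hm
  obtain ⟨u, hu⟩ := hm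
  have hgu : algebraMap V K (g.coeff m) = c * e * algebraMap V K u := by
    rw [← coeff_map, hab, mul_mul_mul_comm, ← C_mul, ← map_mul, coeff_C_mul, coeff_map, hu]
  have hce : algebraMap V K (g.coeff m * (u⁻¹ : Vˣ)) = c * e := by
    rw [map_mul, hgu, mul_assoc, ← map_mul, Units.mul_inv, map_one, mul_one]
  set w := g.coeff m * (u⁻¹ : Vˣ)
  have key : ∀ {x : K} (_ : x ≠ 0) (p : MvPolynomial σ K),
      (C x * p).totalDegree = p.totalDegree := fun hx p ↦ by
    obtain rfl | hp := eq_or_ne p 0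
    · rw [mul_zero]
    · rw [totalDegree_mul_of_isDomain (C_ne_zero.mpr hx) hp, totalDegree_C, zero_add]
  refine ⟨C w * a', b', map_injective _ hinj ?_, ?_, ?_⟩
  · simp only [hab, map_mul, map_C, hce]
    ring
  · rw [key hc, ← totalDegree_map_of_injective hinj, map_mul, map_C, hce,
      key (mul_ne_zero hc he)]
  · rw [key he, totalDegree_map_of_injective hinj]

/-- A factorization of `g` over a domain whose maximal ideal lies over that of `A` specializes
to a factorization over a finite extension of the residue field of `A`. -/
theorem IsLocalRing.exists_finite_extension_reducible {A V : Type u} [CommRing A] [IsLocalRing A]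
    [CommRing V] [IsDomain V] [IsLocalRing V] [Algebra A V] [IsLocalHom (algebraMap A V)]
    {σ : Type*} {g : MvPolynomial σ A} (hg : map (residue A) g ≠ 0)
    (hdeg : g.totalDegree ≤ (map (residue A) g).totalDegree) {a b : MvPolynomial σ V}
    (hab : map (algebraMap A V) g = a * b) (ha : a.totalDegree ≠ 0) (hb : b.totalDegree ≠ 0) :
    ∃ (L : Type u) (_ : Field L) (_ : Algebra (ResidueField A) L)
      (_ : FiniteDimensional (ResidueField A) L),
      MvPolyReducible (map ((algebraMap (ResidueField A) L).comp (residue A)) g) := by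
  classical
  let B : Subalgebra A V := Algebra.adjoin A (a.coeffs ∪ b.coeffs : Finset V)
  have hBV : Function.Injective (algebraMap B V) := Subtype.val_injective
  have hlift : ∀ p : MvPolynomial σ V, p.coeffs ⊆ a.coeffs ∪ b.coeffs →
      ∃ q : MvPolynomial σ B, map (algebraMap B V) q = p := fun p hp ↦
    mem_range_map_iff_coeffs_subset.mpr fun x hx ↦ ⟨⟨x, Algebra.subset_adjoin (hp hx)⟩, rfl⟩
  obtain ⟨p, hp⟩ := hlift a Finset.subset_union_left
  obtain ⟨q, hq⟩ := hlift b Finset.subset_union_right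
  rw [← hp, totalDegree_map_of_injective hBV] at ha
  rw [← hq, totalDegree_map_of_injective hBV] at hb
  have hB : map (algebraMap A B) g = p * q := by
    apply map_injective _ hBV
    rw [map_map, ← IsScalarTower.algebraMap_eq, hab, map_mul, hp, hq]
  have hne : (maximalIdeal A).map (algebraMap A B) ≠ ⊤ := by
    refine ne_top_of_le_ne_top
      (Ideal.comap_ne_top (algebraMap B V) (maximalIdeal.isMaximal V).ne_top) ?_
    rw [Ideal.map_le_iff_le_comap, Ideal.comap_comap, ← IsScalarTower.algebraMap_eq]
    exact ((local_hom_TFAE (algebraMap A V)).out 0 3).mp ‹_›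
  obtain ⟨M, hM, hle⟩ := Ideal.exists_le_maximal _ hne
  let : Field (B ⧸ M) := Ideal.Quotient.field M
  have hker : ∀ x ∈ maximalIdeal A, algebraMap A (B ⧸ M) x = 0 := fun x hx ↦
    Ideal.Quotient.eq_zero_iff_mem.mpr (hle (Ideal.mem_map_of_mem _ hx))
  let : Algebra (ResidueField A) (B ⧸ M) :=
    (Ideal.Quotient.lift (maximalIdeal A) (algebraMap A (B ⧸ M)) hker).toAlgebra
  have : IsScalarTower A (ResidueField A) (B ⧸ M) := .of_algebraMap_eq fun x ↦ rfl
  have : Algebra.FiniteType A B :=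
    (Subalgebra.fg_iff_finiteType _).mp ⟨_, rfl⟩
  have : Algebra.FiniteType A (B ⧸ M) :=
    .of_surjective (Ideal.Quotient.mkₐ A M) Ideal.Quotient.mk_surjective
  have : Algebra.FiniteType (ResidueField A) (B ⧸ M) := .of_restrictScalars_finiteType A _ _
  have hinj := (algebraMap (ResidueField A) (B ⧸ M)).injective
  have hred : map ((algebraMap (ResidueField A) (B ⧸ M)).comp (residue A)) g =
      map (Ideal.Quotient.mk M) p * map (Ideal.Quotient.mk M) q := by
    rw [← map_mul, ← hB, map_map]
    rfl
  have hprod : map (Ideal.Quotient.mk M) p * map (Ideal.Quotient.mk M) q ≠ 0 := by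
    rw [← hred, ← map_map, map_ne_zero_iff _ (map_injective _ hinj)]
    exact hg
  have hp0 := left_ne_zero_of_mul hprod
  have hq0 := right_ne_zero_of_mul hprod
  have hsum : p.totalDegree + q.totalDegree ≤
      (map (Ideal.Quotient.mk M) p).totalDegree + (map (Ideal.Quotient.mk M) q).totalDegree := by
    rw [← totalDegree_mul_of_isDomain hp0 hq0, ← hred, ← map_map,
      totalDegree_map_of_injective hinj,
      ← totalDegree_mul_of_isDomain (fun h ↦ ha (by simp [h])) (fun h ↦ hb (by simp [h])), ← hB]
    exact (totalDegree_map_le _ _).trans hdeg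
  have hple := totalDegree_map_le (Ideal.Quotient.mk M) p
  have hqle := totalDegree_map_le (Ideal.Quotient.mk M) q
  refine ⟨B ⧸ M, inferInstance, inferInstance, finite_of_finite_type_of_isJacobsonRing _ _,
    _, _, hred, ?_, ?_⟩
  · rw [not_isUnit_iff_totalDegree_ne_zero hp0]
    lia
  · rw [not_isUnit_iff_totalDegree_ne_zero hq0]
    lia

/-- Claim 2: let `A` be a one-dimensional Noetherian local integral domain with maximal
ideal `𝔪`. If `g ∈ A[x₁,…,xₙ]` of total degree `d`, viewed over `Q(A)`, becomes reducible
over some finite extension of `Q(A)`, then the reduction of `g` modulo `𝔪` has total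
degree `< d` or is reducible over some finite extension of `A/𝔪`. -/
theorem reducible_reduction_local {A : Type u} [CommRing A] [IsDomain A]
    [IsNoetherianRing A] [IsLocalRing A] (hdim : ringKrullDim A = 1)
    {n : ℕ} (g : MvPolynomial (Fin n) A) (d : ℕ) (hd : g.totalDegree = d)
    (h : ∃ (L : Type u) (_ : Field L) (_ : Algebra (FractionRing A) L)
        (_ : FiniteDimensional (FractionRing A) L),
        MvPolyReducible
          (MvPolynomial.map ((algebraMap (FractionRing A) L).comp
            (algebraMap A (FractionRing A))) g)) :
    (MvPolynomial.map (IsLocalRing.residue A) g).totalDegree < d ∨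
      ∃ (L : Type u) (_ : Field L) (_ : Algebra (IsLocalRing.ResidueField A) L)
        (_ : FiniteDimensional (IsLocalRing.ResidueField A) L),
        MvPolyReducible
          (MvPolynomial.map ((algebraMap (IsLocalRing.ResidueField A) L).comp
            (IsLocalRing.residue A)) g) := by
  by_cases hdeg : (map (residue A) g).totalDegree < d
  · exact .inl hdeg
  right
  by_cases hg : map (residue A) g = 0
  · exact ⟨ResidueField A, inferInstance, inferInstance, inferInstance, 0, 0,
      by rw [← map_map, hg, map_zero, mul_zero], not_isUnit_zero, not_isUnit_zero⟩
  obtain ⟨L, _, _, _, a, b, hab, ha, hb⟩ := h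
  have hinj : Function.Injective ((algebraMap (FractionRing A) L).comp
      (algebraMap A (FractionRing A))) :=
    (algebraMap (FractionRing A) L).injective.comp (IsFractionRing.injective A (FractionRing A))
  set f := (algebraMap (FractionRing A) L).comp (algebraMap A (FractionRing A))
  obtain ⟨V, hV, hloc⟩ := exists_factor_valuationRing f
  let : Algebra A V := (f.codRestrict V.toSubring hV).toAlgebra
  have : IsLocalHom (algebraMap A V) := hloc
  have hgV : map (residue V) (map (algebraMap A V) g) ≠ 0 := by
    rw [map_map, ← ResidueField.map_comp_residue, ← map_map,
      map_ne_zero_iff _ (map_injective _ (RingHom.injective _))]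
    exact hg
  have hgL : map (algebraMap V L) (map (algebraMap A V) g) = a * b := by
    rw [map_map, ← hab]
    rfl
  have hg0 : a * b ≠ 0 := by
    rw [← hab, map_ne_zero_iff _ (map_injective _ hinj)]
    rintro rfl
    exact hg (map_zero _)
  obtain ⟨a', b', hab', ha', hb'⟩ := V.exists_factorization hgV hgL
  rw [not_isUnit_iff_totalDegree_ne_zero (left_ne_zero_of_mul hg0), ← ha'] at ha
  rw [not_isUnit_iff_totalDegree_ne_zero (right_ne_zero_of_mul hg0), ← hb'] at hb
  exact exists_finite_extension_reducible hg (hd.trans_le (not_lt.mp hdeg)) hab' ha hb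
end

section
/- Let B be the generic symmetric 5×5 matrix with entries b_ij (1 ≤ i ≤ j ≤ 5). Then the resolvent Φ(z; Id_5, B), regarded as a polynomial in the 16 variables z and (b_ij)_{1 ≤ i ≤ j ≤ 5}, is irreducible over the algebraic closure ℚ̄ of ℚ. -/
open MvPolynomial

/-- An algebraic closure of `ℚ`. -/
noncomputable abbrev Qbar : Type := AlgebraicClosure ℚ

/-- Index set for the 15 entries `1 ≤ i ≤ j ≤ 5` of a generic symmetric `5×5` matrix
(0-based indices). -/
def Sym5 : Type := {p : Fin 5 × Fin 5 // p.1 ≤ p.2}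

/-- The 16 variables: `none` is `z`, `some p` is the matrix entry `b_p`. -/
def Var16 : Type := Option Sym5

/-- The specialization of the generic symmetric matrix at which the characteristic polynomial becomes
`λ⁵ - 4λ + 4t`; here `w` is a square root of `-1`. -/
def quinticSymmMatrix {R : Type*} [CommRing R] (w t : R) : Matrix (Fin 5) (Fin 5) R :=
  !![t, 1, 0, w, w * t;
     1, 0, 1, 0, 0;
     0, 1, 0, -w, 0;
     w, 0, -w, 0, 0;
     w * t, 0, 0, 0, -t]

theorem quinticSymmMatrix_isSymm {R : Type*} [CommRing R] (w t : R) :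
    (quinticSymmMatrix w t).IsSymm := by
  ext i j
  fin_cases i <;> fin_cases j <;> rfl

theorem map_quinticSymmMatrix {R S : Type*} [CommRing R] [CommRing S] (f : R →+* S) (w t : R)
    (i j : Fin 5) : f (quinticSymmMatrix w t i j) = quinticSymmMatrix (f w) (f t) i j := by
  fin_cases i <;> fin_cases j <;> simp [quinticSymmMatrix]

theorem det_add_quinticSymmMatrix {R : Type*} [CommRing R] (w t x : R) (hw : w ^ 2 = -1) :
    Matrix.det (Matrix.of fun i j => (if i = j then x else 0) + quinticSymmMatrix w t i j) =
      x ^ 5 - 4 * x + 4 * t := by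
  have hM : (Matrix.of fun i j => (if i = j then x else 0) + quinticSymmMatrix w t i j) =
      !![x + t, 1, 0, w, w * t;
         1, x, 1, 0, 0;
         0, 1, x, -w, 0;
         w, 0, -w, x, 0;
         w * t, 0, 0, 0, x - t] := by
    ext i j
    fin_cases i <;> fin_cases j <;> simp [quinticSymmMatrix, sub_eq_add_neg]
  have hw4 : w ^ 4 = 1 := by rw [show w ^ 4 = (w ^ 2) ^ 2 by ring, hw]; ring
  rw [hM]
  simp [Matrix.det_succ_row_zero, Fin.sum_univ_succ, Fin.succAbove]
  ring_nf
  simp only [hw, hw4]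
  ring

/-- The pair-sum resolvent of a quintic in Bring-Jerrard form in terms of its coefficients. -/
theorem prod_add_pair_sums_of_bring_jerrard {R : Type*} [CommRing R] (z a b c d e p q : R)
    (h₁ : a + b + c + d + e = 0)
    (h₂ : a * b + a * c + a * d + a * e + b * c + b * d + b * e + c * d + c * e + d * e = 0)
    (h₃ : a * b * c + a * b * d + a * b * e + a * c * d + a * c * e + a * d * e
      + b * c * d + b * c * e + b * d * e + c * d * e = 0)
    (h₄ : a * b * c * d + a * b * c * e + a * b * d * e + a * c * d * e + b * c * d * e = p)
    (h₅ : a * b * c * d * e = q) :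
    (z + a + b) * ((z + a + c) * (z + a + d) * (z + a + e))
        * ((z + b + c) * (z + b + d) * (z + b + e))
        * ((z + c + d) * (z + c + e) * (z + d + e)) =
      z ^ 10 - 3 * p * z ^ 6 - 11 * q * z ^ 5 - 4 * p ^ 2 * z ^ 2 + 4 * p * q * z - q ^ 2 := by
  have hl : c + d + e = -(a + b) := by linear_combination h₁
  have hm : c * d + c * e + d * e = (a + b) ^ 2 - a * b := by
    linear_combination h₂ - (a + b) * hl
  have hn : c * d * e = (a + b) * (a * b - ((a + b) ^ 2 - a * b)) := by
    linear_combination h₃ - a * b * hl - (a + b) * hm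
  have hg (y : R) : (y + c) * (y + d) * (y + e) =
      y ^ 3 - (a + b) * y ^ 2 + ((a + b) ^ 2 - a * b) * y
        + (a + b) * (a * b - ((a + b) ^ 2 - a * b)) := by
    linear_combination y ^ 2 * hl + y * hm + hn
  have hp : p = a * b * ((a + b) ^ 2 - a * b)
      + (a + b) * ((a + b) * (a * b - ((a + b) ^ 2 - a * b))) := by
    linear_combination -h₄ + a * b * hm + (a + b) * hn
  have hq : q = a * b * ((a + b) * (a * b - ((a + b) ^ 2 - a * b))) := by
    linear_combination -h₅ + a * b * hn
  have hpairs : (z + c + d) * (z + c + e) * (z + d + e) =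
      -((a + b - z + c) * (a + b - z + d) * (a + b - z + e)) := by
    rw [show z + c + d = -(a + b - z + e) by linear_combination hl,
      show z + c + e = -(a + b - z + d) by linear_combination hl,
      show z + d + e = -(a + b - z + c) by linear_combination hl]
    ring
  rw [hpairs, hg, hg, hg, hp, hq]
  ring

theorem prod_add_pair_sums_of_quintic {K : Type*} [CommRing K] (t : K) (α : Fin 5 → K)
    (h : (Polynomial.X ^ 5 - 4 * Polynomial.X + 4 * Polynomial.C t : Polynomial K) =
      ∏ i : Fin 5, (Polynomial.X + Polynomial.C (α i))) (z : K) :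
    ∏ i : Fin 5, ∏ j ∈ Finset.Ioi i, (z + α i + α j) =
      z ^ 10 + 12 * z ^ 6 - 44 * t * z ^ 5 - 64 * z ^ 2 - 64 * t * z - 16 * t ^ 2 := by
  have expand (a b c d e : K) : (Polynomial.X + Polynomial.C a) * (Polynomial.X + Polynomial.C b)
      * (Polynomial.X + Polynomial.C c) * (Polynomial.X + Polynomial.C d)
      * (Polynomial.X + Polynomial.C e) = Polynomial.X ^ 5
        + Polynomial.C (a + b + c + d + e) * Polynomial.X ^ 4
        + Polynomial.C (a * b + a * c + a * d + a * e + b * c + b * d + b * e + c * d + c * e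
          + d * e) * Polynomial.X ^ 3
        + Polynomial.C (a * b * c + a * b * d + a * b * e + a * c * d + a * c * e + a * d * e
          + b * c * d + b * c * e + b * d * e + c * d * e) * Polynomial.X ^ 2
        + Polynomial.C (a * b * c * d + a * b * c * e + a * b * d * e + a * c * d * e
          + b * c * d * e) * Polynomial.X ^ 1
        + Polynomial.C (a * b * c * d * e) := by
    simp only [map_add, map_mul]
    ring
  have h' : (Polynomial.X ^ 5 + Polynomial.C (-4) * Polynomial.X ^ 1 + Polynomial.C (4 * t) :
      Polynomial K) = ∏ i : Fin 5, (Polynomial.X + Polynomial.C (α i)) := by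
    rw [← h]
    simp only [map_mul, map_neg, Polynomial.C_ofNat]
    ring
  rw [Fin.prod_univ_five, expand] at h'
  have hc (n : ℕ) := congrArg (fun p => Polynomial.coeff p n) h'
  have h₁ := hc 4
  have h₂ := hc 3
  have h₃ := hc 2
  have h₄ := hc 1
  have h₅ := hc 0
  simp only [Polynomial.coeff_add, Polynomial.coeff_C_mul, Polynomial.coeff_X_pow,
    Polynomial.coeff_C] at h₁ h₂ h₃ h₄ h₅
  norm_num at h₁ h₂ h₃ h₄ h₅
  have key := prod_add_pair_sums_of_bring_jerrard z (α 0) (α 1) (α 2) (α 3) (α 4) (-4) (4 * t)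
    h₁.symm h₂.symm h₃.symm h₄.symm h₅.symm
  have hI0 : Finset.Ioi (0 : Fin 5) = {1, 2, 3, 4} := by decide
  have hI1 : Finset.Ioi (1 : Fin 5) = {2, 3, 4} := by decide
  have hI2 : Finset.Ioi (2 : Fin 5) = {3, 4} := by decide
  have hI3 : Finset.Ioi (3 : Fin 5) = {4} := by decide
  have hI4 : Finset.Ioi (4 : Fin 5) = ∅ := by decide
  rw [Fin.prod_univ_five, hI0, hI1, hI2, hI3, hI4]
  simp only [Finset.prod_empty, Finset.prod_singleton]
  repeat rw [Finset.prod_insert (by decide)]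
  simp only [Finset.prod_singleton]
  rw [show z ^ 10 + 12 * z ^ 6 - 44 * t * z ^ 5 - 64 * z ^ 2 - 64 * t * z - 16 * t ^ 2 =
    z ^ 10 - 3 * -4 * z ^ 6 - 11 * (4 * t) * z ^ 5 - 4 * (-4) ^ 2 * z ^ 2 + 4 * -4 * (4 * t) * z
      - (4 * t) ^ 2 by ring, ← key]
  simp only [mul_assoc, mul_one]

/-- The pair-sum resolvent of `λ⁵ - 4λ + 4t`, as a polynomial in `z` over `K[t]`. -/
noncomputable def quinticResolvent (K : Type*) [CommRing K] : Polynomial (Polynomial K) :=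
  Polynomial.X ^ 10 + 12 * Polynomial.X ^ 6 - 44 * Polynomial.C Polynomial.X * Polynomial.X ^ 5
    - 64 * Polynomial.X ^ 2 - 64 * Polynomial.C Polynomial.X * Polynomial.X
    - 16 * Polynomial.C Polynomial.X ^ 2

theorem sq_ne_of_simple_root {K : Type*} [CommRing K] [IsDomain K] {p s : Polynomial K} {x : K}
    (hp : p.eval x = 0) (hp' : p.derivative.eval x ≠ 0) : s ^ 2 ≠ p := by
  rintro rfl
  have hs : s.eval x = 0 := by simpa using hp
  exact hp' (by simp [Polynomial.derivative_pow, hs])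

theorem irreducible_quinticResolvent (K : Type*) [Field K] [CharZero K] [IsAlgClosed K] :
    Irreducible (quinticResolvent K) := by
  set b : Polynomial K := Polynomial.C (1 / 4) * (11 * Polynomial.X ^ 5 + 16 * Polynomial.X) with hb
  set c : Polynomial K := -Polynomial.C (1 / 16) *
    (Polynomial.X ^ 10 + 12 * Polynomial.X ^ 6 - 64 * Polynomial.X ^ 2) with hc
  have h4 : Polynomial.C (1 / 4 : K) * 4 = 1 := by
    rw [← Polynomial.C_ofNat, ← map_mul]; norm_num
  have h16 : Polynomial.C (1 / 16 : K) * 16 = 1 := by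
    rw [← Polynomial.C_ofNat, ← map_mul]; norm_num
  set q : Polynomial (Polynomial K) :=
    Polynomial.X ^ 2 + Polynomial.C b * Polynomial.X + Polynomial.C c with hq
  have hdeg : q.natDegree = 2 := by rw [hq]; compute_degree!
  have hmonic : q.Monic := by rw [hq]; monicity!
  have hirr : Irreducible q := by
    rw [hmonic.irreducible_iff_roots_eq_zero_of_degree_le_three hdeg.ge (by lia)]
    refine Multiset.eq_zero_of_forall_notMem fun r hr => ?_
    have hr' : r ^ 2 + b * r + c = 0 := by
      simpa [hq, Polynomial.IsRoot] using Polynomial.isRoot_of_mem_roots hr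
    obtain ⟨x, hx⟩ := IsAlgClosed.exists_pow_nat_eq (-(16 / 5) : K) (n := 4) (by norm_num)
    have hx0 : x ≠ 0 := by rintro rfl; norm_num at hx
    have hsq : (8 * r + 11 * Polynomial.X ^ 5 + 16 * Polynomial.X) ^ 2 =
        (125 * Polynomial.X ^ 10 + 400 * Polynomial.X ^ 6 : Polynomial K) := by
      rw [hb, hc] at hr'
      linear_combination 64 * hr'
        - 16 * r * (11 * Polynomial.X ^ 5 + 16 * Polynomial.X) * h4
        + 4 * (Polynomial.X ^ 10 + 12 * Polynomial.X ^ 6 - 64 * Polynomial.X ^ 2) * h16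
    refine sq_ne_of_simple_root (x := x) ?_ ?_ hsq
    · simp
      linear_combination 125 * x ^ 6 * hx
    · have : (Polynomial.derivative
          (125 * Polynomial.X ^ 10 + 400 * Polynomial.X ^ 6 : Polynomial K)).eval x =
          -1600 * x ^ 5 := by
        simp [Polynomial.derivative_pow]
        linear_combination 1250 * x ^ 5 * hx
      rw [this]
      simp [hx0]
  have hswap : Polynomial.Bivariate.swap (quinticResolvent K) =
      Polynomial.C (Polynomial.C (-16)) * q := by
    have h4' := congrArg Polynomial.C h4
    have h16' := congrArg Polynomial.C h16
    simp only [map_mul, map_one, map_ofNat] at h4' h16'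
    simp only [quinticResolvent, map_add, map_sub, map_mul, map_pow, map_ofNat,
      Polynomial.Bivariate.swap_X, Polynomial.Bivariate.swap_Y, hq, hb, hc, map_neg]
    linear_combination 4 * (11 * Polynomial.C Polynomial.X ^ 5 + 16 * Polynomial.C Polynomial.X)
      * Polynomial.X * h4' - (Polynomial.C Polynomial.X ^ 10 + 12 * Polynomial.C Polynomial.X ^ 6
        - 64 * Polynomial.C Polynomial.X ^ 2) * h16'
  rw [← MulEquiv.irreducible_iff (Polynomial.Bivariate.swap (R := K)), hswap]
  have hunit : IsUnit (Polynomial.C (Polynomial.C (-16 : K))) :=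
    ((isUnit_iff_ne_zero.2 (by norm_num)).map Polynomial.C).map Polynomial.C
  exact (irreducible_isUnit_mul hunit).2 hirr

theorem exists_eq_prod_X_add_C {K : Type*} [Field K] [IsAlgClosed K] {n : ℕ} {p : Polynomial K}
    (hp : p.Monic) (hn : p.natDegree = n) :
    ∃ α : Fin n → K, p = ∏ i, (Polynomial.X + Polynomial.C (α i)) := by
  have hs := IsAlgClosed.splits p
  have hlen : p.roots.toList.length = n := by
    rw [Multiset.length_toList, ← hs.natDegree_eq_card_roots, hn]
  subst hlen
  refine ⟨fun i => -p.roots.toList.get i, ?_⟩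
  conv_lhs => rw [hs.eq_prod_roots_of_monic hp, ← Multiset.coe_toList p.roots]
  rw [Multiset.map_coe, Multiset.prod_coe, ← Fin.prod_univ_fun_getElem]
  simp [sub_eq_add_neg]

theorem exists_det_X_add_eq_prod {K : Type*} [Field K] [IsAlgClosed K] {n : ℕ}
    (B : Matrix (Fin n) (Fin n) K) :
    ∃ α : Fin n → K, Matrix.det (Matrix.of fun i j =>
        (if i = j then Polynomial.X else 0) + Polynomial.C (B i j)) =
      ∏ i, (Polynomial.X + Polynomial.C (α i)) := by
  have h : (Matrix.of fun i j => (if i = j then Polynomial.X else 0) + Polynomial.C (B i j)) =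
      (-B).charmatrix := by
    ext1 i j
    rw [Matrix.charmatrix_apply, Matrix.diagonal_apply, Matrix.neg_apply, map_neg, sub_neg_eq_add,
      Matrix.of_apply]
  rw [h]
  exact exists_eq_prod_X_add_C (-B).charpoly_monic 
    ((-B).charpoly_natDegree_eq_dim.trans (Fintype.card_fin n))

theorem monic_prod_X_add_pair_sums {K : Type*} [CommRing K] (α : Fin 5 → K) :
    (∏ i : Fin 5, ∏ j ∈ Finset.Ioi i,
      (Polynomial.X + Polynomial.C (α i + α j))).Monic :=
  Polynomial.monic_prod_of_monic _ _ fun _ _ =>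
    Polynomial.monic_prod_of_monic _ _ fun _ _ => Polynomial.monic_X_add_C _

theorem natDegree_prod_X_add_pair_sums {K : Type*} [CommRing K] [Nontrivial K] (α : Fin 5 → K) :
    (∏ i : Fin 5, ∏ j ∈ Finset.Ioi i,
      (Polynomial.X + Polynomial.C (α i + α j))).natDegree = 10 := by
  rw [Polynomial.natDegree_prod_of_monic _ _ fun _ _ =>
    Polynomial.monic_prod_of_monic _ _ fun _ _ => Polynomial.monic_X_add_C _]
  simp_rw [Polynomial.natDegree_prod_of_monic _ _ fun _ _ => Polynomial.monic_X_add_C _,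
    Polynomial.natDegree_X_add_C]
  decide

theorem monic_of_forall_map_eval_monic {K σ : Type*} [CommRing K] [IsDomain K] [Infinite K]
    {P : Polynomial (MvPolynomial σ K)} {n : ℕ}
    (h : ∀ v : σ → K, (P.map (MvPolynomial.eval v)).Monic ∧
      (P.map (MvPolynomial.eval v)).natDegree = n) : P.Monic := by
  refine Polynomial.monic_of_natDegree_le_of_coeff_eq_one n ?_ ?_
  · refine Polynomial.natDegree_le_iff_coeff_eq_zero.2 fun m hm => MvPolynomial.funext fun v => ?_
    rw [← Polynomial.coeff_map, map_zero]
    exact Polynomial.coeff_eq_zero_of_natDegree_lt ((h v).2.trans_lt hm)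
  · refine MvPolynomial.funext fun v => ?_
    rw [← Polynomial.coeff_map, map_one]
    have := (h v).1.coeff_natDegree
    rwa [(h v).2] at this

/-- Any polynomial `Φ` in the 16 variables `z` and `(b_ij)_{1 ≤ i ≤ j ≤ 5}` which
specializes, for every symmetric matrix `B` over `ℚ̄` with
`det(λ·Id₅ + B) = ∏ᵢ (λ + αᵢ)`, to the value `∏_{i<j} (z + αᵢ + αⱼ)` — i.e. the resolvent
`Φ(z; Id₅, B)` — is irreducible over `ℚ̄`. -/
theorem resolvent_generic_absolutely_irreducible (Φ : MvPolynomial Var16 Qbar)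
    (hΦ : ∀ B : Matrix (Fin 5) (Fin 5) Qbar, B.IsSymm →
      ∀ α : Fin 5 → Qbar,
        Matrix.det (Matrix.of fun i j =>
            (if i = j then Polynomial.X else 0) + Polynomial.C (B i j)) =
          ∏ i : Fin 5, (Polynomial.X + Polynomial.C (α i)) →
        ∀ z : Qbar,
          MvPolynomial.eval (fun v : Var16 => v.elim z (fun p => B p.val.1 p.val.2)) Φ =
            ∏ i : Fin 5, ∏ j ∈ Finset.Ioi i, (z + α i + α j)) :
    Irreducible Φ := by
  set P := MvPolynomial.optionEquivLeft Qbar Sym5 Φ with hP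
  have hmap (B : Matrix (Fin 5) (Fin 5) Qbar) (hB : B.IsSymm) (α : Fin 5 → Qbar)
      (hα : Matrix.det (Matrix.of fun i j =>
          (if i = j then Polynomial.X else 0) + Polynomial.C (B i j)) =
        ∏ i : Fin 5, (Polynomial.X + Polynomial.C (α i))) :
      P.map (MvPolynomial.eval fun p : Sym5 => B p.val.1 p.val.2) =
        ∏ i : Fin 5, ∏ j ∈ Finset.Ioi i, (Polynomial.X + Polynomial.C (α i + α j)) := by
    refine Polynomial.funext fun z => ?_
    refine (MvPolynomial.optionEquivLeft_elim_eval Qbar Sym5 _ z Φ).symm.trans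
      ((hΦ B hB α hα z).trans ?_)
    simp [Polynomial.eval_prod, add_assoc]
  have hmonic : P.Monic := by
    refine monic_of_forall_map_eval_monic (n := 10) fun v => ?_
    let B : Matrix (Fin 5) (Fin 5) Qbar := fun i j => v ⟨(min i j, max i j), min_le_max⟩
    have hB : B.IsSymm := Matrix.IsSymm.ext fun i j => by
      simp only [B, min_comm, max_comm]
    have hv : (fun p : Sym5 => B p.val.1 p.val.2) = v := by
      ext ⟨p, hp⟩
      simp [B, min_eq_left hp, max_eq_right hp]
    obtain ⟨α, hα⟩ := exists_det_X_add_eq_prod B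
    have := hmap B hB α hα
    rw [hv] at this
    rw [this]
    exact ⟨monic_prod_X_add_pair_sums α, natDegree_prod_X_add_pair_sums α⟩
  obtain ⟨w, hw⟩ := IsAlgClosed.exists_pow_nat_eq (-1 : Qbar) (n := 2) (by norm_num)
  let φ : MvPolynomial Sym5 Qbar →+* Polynomial Qbar :=
    (MvPolynomial.aeval fun p : Sym5 =>
      quinticSymmMatrix (Polynomial.C w) Polynomial.X p.val.1 p.val.2).toRingHom
  have hφ (t : Qbar) : (Polynomial.evalRingHom t).comp φ =
      MvPolynomial.eval fun p : Sym5 => quinticSymmMatrix w t p.val.1 p.val.2 := by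
    refine MvPolynomial.ringHom_ext (fun r => ?_) fun p => ?_
    · simp [φ]
    · simpa [φ] using map_quinticSymmMatrix (Polynomial.evalRingHom t) (Polynomial.C w)
        Polynomial.X p.val.1 p.val.2
  have hspec : P.map φ = quinticResolvent Qbar := by
    have heval (t : Qbar) : (P.map φ).map (Polynomial.evalRingHom t) =
        (quinticResolvent Qbar).map (Polynomial.evalRingHom t) := by
      have hdet : Matrix.det (Matrix.of fun i j => (if i = j then Polynomial.X else 0) +
          Polynomial.C (quinticSymmMatrix w t i j)) =
          Polynomial.X ^ 5 - 4 * Polynomial.X + 4 * Polynomial.C t := by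
        simp_rw [map_quinticSymmMatrix Polynomial.C w t]
        exact det_add_quinticSymmMatrix _ _ _ (by rw [← map_pow, hw, map_neg, map_one])
      obtain ⟨α, hα⟩ := exists_det_X_add_eq_prod (quinticSymmMatrix w t)
      rw [Polynomial.map_map, hφ, hmap _ (quinticSymmMatrix_isSymm w t) α hα]
      refine Polynomial.funext fun z => ?_
      have := prod_add_pair_sums_of_quintic t α (hdet.symm.trans hα) z
      simpa [Polynomial.eval_prod, quinticResolvent, add_assoc] using this
    ext1 n
    refine Polynomial.funext fun t => ?_
    simpa only [Polynomial.coeff_map, Polynomial.coe_evalRingHom] using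
      congrArg (fun p => p.coeff n) (heval t)
  refine (MulEquiv.irreducible_iff (MvPolynomial.optionEquivLeft Qbar Sym5)).1 ?_
  exact hmonic.irreducible_of_irreducible_map φ P (hspec ▸ irreducible_quinticResolvent Qbar)
end

section
/- Let A be a symmetric 5×5 matrix with integer entries and det(A) ≠ 0. Then there is an absolute constant C, independent of A, such that for all P ≥ 1 the number of symmetric 5×5 integer matrices B = (b_ij) with |b_ij| ≤ P for all 1 ≤ i, j ≤ 5, for which the homogeneous degree-5 form f(λ,μ) = det(λA + μB) is not separable (i.e. has a repeated root in ℙ¹ over the algebraic closure of ℚ), is at most C · P^{14}. -/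
open MvPolynomial

/-- The binary quintic form `f(λ,μ) = det(λA + μB)` with coefficients in `ℚ̄`,
for integer matrices `A`, `B`. Variable `0` is `λ`, variable `1` is `μ`. -/
noncomputable def charFormQbar (A B : Matrix (Fin 5) (Fin 5) ℤ) : MvPolynomial (Fin 2) Qbar :=
  Matrix.det (Matrix.of fun i j =>
    X 0 * C ((A i j : Qbar)) + X 1 * C ((B i j : Qbar)))

theorem MvPolynomial.eval₂_intCast {σ R S : Type*} [CommRing R] [CommRing S] (f : R →+* S)
    (g : σ → S) (n : ℤ) : eval₂ f g (n : MvPolynomial σ R) = n :=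
  map_intCast (eval₂Hom f g) n

/-- The polynomial `det(X • A + B)`. -/
noncomputable def pencilPoly {R : Type*} [CommRing R] (A B : Matrix (Fin 5) (Fin 5) R) :
    Polynomial R :=
  ((Polynomial.X : Polynomial R) • A.map Polynomial.C + B.map Polynomial.C).det

/-- The resultant of `det(X • A + B)` and its derivative, in formal degrees `5` and `4`. -/
noncomputable def pencilDisc {R : Type*} [CommRing R] (A B : Matrix (Fin 5) (Fin 5) R) : R :=
  (pencilPoly A B).resultant (pencilPoly A B).derivative 5 4

/-- A numbering of the positions in a symmetric `5 × 5` matrix. -/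
noncomputable def symIndexEquiv : Sym2 (Fin 5) ≃ Fin 15 :=
  Fintype.equivFinOfCardEq (by rw [Sym2.card]; rfl)

/-- The symmetric matrix with the given 15 coordinates. -/
noncomputable def symMatrix {R : Type*} (x : Fin 15 → R) : Matrix (Fin 5) (Fin 5) R :=
  Matrix.of fun i j => x (symIndexEquiv s(i, j))

theorem exists_eq_symMatrix {R : Type*} {B : Matrix (Fin 5) (Fin 5) R} (hB : B.IsSymm) :
    ∃ x : Fin 15 → R, symMatrix x = B ∧ ∀ k, ∃ i j, x k = B i j := by
  refine ⟨fun k => Sym2.lift ⟨fun i j => B i j, fun i j => hB.apply j i⟩ (symIndexEquiv.symm k),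
    by ext i j; simp [symMatrix], fun k => ?_⟩
  obtain ⟨⟨i, j⟩, hij⟩ := Sym2.mk_surjective (symIndexEquiv.symm k)
  exact ⟨i, j, by simp [← hij]⟩

theorem symMatrix_map {R S : Type*} (φ : R → S) (x : Fin 15 → R) :
    (symMatrix x).map φ = symMatrix (φ ∘ x) := rfl

section CommRing

variable {R S : Type*} [CommRing R] [CommRing S]

theorem pencilPoly_map (φ : R →+* S) (A B : Matrix (Fin 5) (Fin 5) R) :
    (pencilPoly A B).map φ = pencilPoly (A.map φ) (B.map φ) := by
  rw [pencilPoly, pencilPoly, ← Polynomial.coe_mapRingHom, RingHom.map_det]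
  congr 1
  ext1 i j
  simp

theorem map_pencilDisc (φ : R →+* S) (A B : Matrix (Fin 5) (Fin 5) R) :
    φ (pencilDisc A B) = pencilDisc (A.map φ) (B.map φ) := by
  rw [pencilDisc, pencilDisc, ← Polynomial.resultant_map_map, ← Polynomial.derivative_map,
    pencilPoly_map]

theorem natDegree_pencilPoly {A : Matrix (Fin 5) (Fin 5) R} (hA : A.det ≠ 0)
    (B : Matrix (Fin 5) (Fin 5) R) : (pencilPoly A B).natDegree = 5 :=
  Polynomial.natDegree_eq_of_le_of_coeff_ne_zero
    (by simpa [pencilPoly] using Polynomial.natDegree_det_X_add_C_le A B)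
    (by simpa [pencilPoly] using (Polynomial.coeff_det_X_add_C_card A B).trans_ne hA)

end CommRing

theorem pencilDisc_eq_zero_of_double_root {K : Type*} [Field K] [IsAlgClosed K]
    {A B : Matrix (Fin 5) (Fin 5) K} (hA : A.det ≠ 0) {r : K}
    (h₀ : (pencilPoly A B).eval r = 0) (h₁ : (pencilPoly A B).derivative.eval r = 0) :
    pencilDisc A B = 0 := by
  have hdeg := natDegree_pencilPoly hA B
  have hne : pencilPoly A B ≠ 0 := fun h => by simp [h] at hdeg
  have h := Polynomial.resultant_eq_prod_eval (pencilPoly A B) (pencilPoly A B).derivative 4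
    ((Polynomial.natDegree_derivative_le _).trans (by omega)) (IsAlgClosed.splits _)
  rw [hdeg] at h
  rw [pencilDisc, h, Multiset.prod_eq_zero, mul_zero]
  exact Multiset.mem_map.2 ⟨r, (Polynomial.mem_roots hne).2 h₀, h₁⟩

theorem pencilDisc_ne_zero_of_separable {K : Type*} [Field K] [CharZero K]
    {A B : Matrix (Fin 5) (Fin 5) K} (hA : A.det ≠ 0) (h : (pencilPoly A B).Separable) :
    pencilDisc A B ≠ 0 := by
  have hdeg := natDegree_pencilPoly hA B
  have hdeg' : (pencilPoly A B).derivative.natDegree = 4 := by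
    rw [Polynomial.natDegree_derivative, hdeg]
  have := Polynomial.resultant_ne_zero _ _ h
  rwa [hdeg, hdeg'] at this

theorem exists_isSymm_pencilDisc_ne_zero {A : Matrix (Fin 5) (Fin 5) ℝ} (hA : A.IsSymm)
    (hdet : A.det ≠ 0) : ∃ B : Matrix (Fin 5) (Fin 5) ℝ, B.IsSymm ∧ pencilDisc A B ≠ 0 := by
  have hH : A.IsHermitian := by
    rw [Matrix.IsHermitian, Matrix.conjTranspose_eq_transpose_of_trivial]; exact hA
  obtain ⟨U, d, hU, hAU⟩ : ∃ (U : Matrix (Fin 5) (Fin 5) ℝ) (d : Fin 5 → ℝ),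
      U * U.transpose = 1 ∧ A = U * Matrix.diagonal d * U.transpose := by
    refine ⟨hH.eigenvectorUnitary, hH.eigenvalues, ?_, ?_⟩
    · have := Unitary.coe_mul_star_self hH.eigenvectorUnitary
      rwa [Unitary.coe_star, Matrix.star_eq_conjTranspose,
        Matrix.conjTranspose_eq_transpose_of_trivial] at this
    · have := hH.spectral_theorem
      rwa [Unitary.conjStarAlgAut_apply, Matrix.star_eq_conjTranspose,
        Matrix.conjTranspose_eq_transpose_of_trivial] at this
  have hdetU : U.det * U.det = 1 := by
    simpa using congrArg Matrix.det hU
  have hd : ∏ i, d i ≠ 0 := by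
    rw [hAU] at hdet
    intro h
    simp [h] at hdet
  let e : Fin 5 → ℝ := fun i => d i * (-(i : ℝ))
  let B := U * Matrix.diagonal e * U.transpose
  have hB : B.IsSymm := by
    simp [B, Matrix.IsSymm, Matrix.transpose_mul, Matrix.mul_assoc]
  have hpoly : pencilPoly A B =
      Polynomial.C (∏ i, d i) * ∏ i : Fin 5, (Polynomial.X - Polynomial.C (i : ℝ)) := by
    have hmat : (Polynomial.X : Polynomial ℝ) • A.map Polynomial.C + B.map Polynomial.C =
        U.map Polynomial.C * Matrix.diagonal (fun i => Polynomial.C (d i) *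
          (Polynomial.X - Polynomial.C (i : ℝ))) * U.transpose.map Polynomial.C := by
      have hdiag : Matrix.diagonal (fun i => Polynomial.C (d i) *
          (Polynomial.X - Polynomial.C (i : ℝ))) =
          (Polynomial.X : Polynomial ℝ) • (Matrix.diagonal d).map Polynomial.C +
            (Matrix.diagonal e).map Polynomial.C := by
        ext1 i j
        by_cases h : i = j
        · subst h
          simp [e]
          ring
        · simp [h]
      rw [hdiag, hAU]
      simp only [B, Matrix.map_mul, Matrix.mul_add, Matrix.add_mul, Matrix.mul_smul,
        Matrix.smul_mul]
    have hdetC (M : Matrix (Fin 5) (Fin 5) ℝ) :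
        (M.map Polynomial.C).det = Polynomial.C M.det := (RingHom.map_det _ _).symm
    rw [pencilPoly, hmat, Matrix.det_mul, Matrix.det_mul, hdetC, hdetC, Matrix.det_transpose,
      mul_right_comm, ← map_mul, hdetU, Matrix.det_diagonal, Finset.prod_mul_distrib, map_prod]
    simp
  refine ⟨B, hB, pencilDisc_ne_zero_of_separable hdet ?_⟩
  rw [hpoly]
  refine Polynomial.Separable.unit_mul (Polynomial.isUnit_C.2 hd.isUnit)
    (Polynomial.separable_prod_X_sub_C_iff.2 fun i j h => ?_)
  exact Fin.ext (by exact_mod_cast h)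

/-- A repeated linear factor of `det(λA + μB)` gives a double root of `det(X • A + B)`. -/
theorem exists_double_root_of_sq_dvd {A B : Matrix (Fin 5) (Fin 5) ℤ} (hA : A.det ≠ 0)
    {l : MvPolynomial (Fin 2) Qbar} (hl : l ≠ 0) (hl₁ : l.IsHomogeneous 1)
    (hdvd : l ^ 2 ∣ charFormQbar A B) :
    ∃ r : Qbar, (pencilPoly (A.map (Int.castRingHom Qbar)) (B.map (Int.castRingHom Qbar))).eval r
        = 0 ∧
      (pencilPoly (A.map (Int.castRingHom Qbar))
        (B.map (Int.castRingHom Qbar))).derivative.eval r = 0 := by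
  obtain ⟨a, b, rfl⟩ : ∃ a b : Qbar, C a * X 0 + C b * X 1 = l := by
    have h := (mem_homogeneousSubmodule 1 l).2 hl₁
    rw [homogeneousSubmodule_one_eq_span_X, Submodule.mem_span_range_iff_exists_fun] at h
    obtain ⟨c, hc⟩ := h
    exact ⟨c 0, c 1, by simpa [MvPolynomial.smul_eq_C_mul] using hc⟩
  obtain ⟨q, hq⟩ := hdvd
  have ha : a ≠ 0 := by
    rintro rfl
    have h := congrArg (eval ![1, 0]) hq
    rw [charFormQbar, RingHom.map_det] at h
    have hA' : (A.map (Int.castRingHom Qbar)).det = 0 := by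
      convert h using 1
      · congr 1
        ext i j
        simp
      · simp
    rw [← RingHom.mapMatrix_apply, ← RingHom.map_det] at hA'
    exact hA (by simpa using hA')
  let φ : MvPolynomial (Fin 2) Qbar →+* Polynomial Qbar :=
    eval₂Hom Polynomial.C ![Polynomial.X, 1]
  have hφ : pencilPoly (A.map (Int.castRingHom Qbar)) (B.map (Int.castRingHom Qbar)) =
      (Polynomial.C a * Polynomial.X + Polynomial.C b) ^ 2 * φ q := by
    have h := congrArg φ hq
    rw [charFormQbar, RingHom.map_det] at h
    convert h using 1
    · rw [pencilPoly]
      congr 1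
      ext1 i j
      simp [φ, eval₂_intCast]
    · simp [φ]
  have hr : a * (-b / a) + b = 0 := by field_simp; ring
  refine ⟨-b / a, ?_, ?_⟩ <;> rw [hφ] <;> simp [hr, Polynomial.derivative_pow]

theorem card_zeros_le {p : MvPolynomial (Fin 15) ℤ} (hp : p ≠ 0) (S : Finset ℤ)
    (hS : S.Nonempty) :
    ({x ∈ Fintype.piFinset fun _ => S | eval x p = 0} : Finset (Fin 15 → ℤ)).card ≤
      p.totalDegree * S.card ^ 14 := by
  have h := schwartz_zippel_totalDegree hp S
  have hc : (0 : ℚ≥0) < S.card := by exact_mod_cast hS.card_pos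
  rw [div_le_div_iff₀ (by positivity) hc, pow_succ, ← mul_assoc] at h
  exact_mod_cast le_of_mul_le_mul_right h hc

/-- `pencilDisc` of a generic matrix and a generic symmetric matrix, as a polynomial in the entries
of the latter. -/
noncomputable def genericPencilDisc :
    MvPolynomial (Fin 15) (MvPolynomial (Fin 5 × Fin 5) ℤ) :=
  pencilDisc (Matrix.of fun i j => C (X (i, j))) (symMatrix X)

/-- The specialization of `genericPencilDisc` at a given first matrix. -/
noncomputable def pencilDiscPoly (A : Matrix (Fin 5) (Fin 5) ℤ) : MvPolynomial (Fin 15) ℤ :=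
  map (eval fun ij : Fin 5 × Fin 5 => A ij.1 ij.2) genericPencilDisc

theorem eval₂_pencilDiscPoly {R : Type*} [CommRing R] (A : Matrix (Fin 5) (Fin 5) ℤ)
    (x : Fin 15 → R) :
    eval₂Hom (Int.castRingHom R) x (pencilDiscPoly A) =
      pencilDisc (A.map (Int.castRingHom R)) (symMatrix x) := by
  rw [pencilDiscPoly, genericPencilDisc, map_pencilDisc, map_pencilDisc]
  congr 1
  · ext1 i j
    simp [eval₂_intCast]
  · ext1 i j
    simp [symMatrix]

theorem pencilDiscPoly_ne_zero {A : Matrix (Fin 5) (Fin 5) ℤ} (hA : A.IsSymm)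
    (hdet : A.det ≠ 0) : pencilDiscPoly A ≠ 0 := by
  have hdet' : (A.map (Int.castRingHom ℝ)).det ≠ 0 := by
    rw [← RingHom.mapMatrix_apply, ← RingHom.map_det]
    simpa using hdet
  obtain ⟨B, hB, hne⟩ := exists_isSymm_pencilDisc_ne_zero (hA.map _) hdet'
  obtain ⟨x, rfl, -⟩ := exists_eq_symMatrix hB
  intro h
  rw [← eval₂_pencilDiscPoly, h, map_zero] at hne
  exact hne rfl

theorem eval_pencilDiscPoly_eq_zero {A : Matrix (Fin 5) (Fin 5) ℤ} (hA : A.det ≠ 0)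
    {x : Fin 15 → ℤ} {l : MvPolynomial (Fin 2) Qbar} (hl : l ≠ 0) (hl₁ : l.IsHomogeneous 1)
    (hdvd : l ^ 2 ∣ charFormQbar A (symMatrix x)) : eval x (pencilDiscPoly A) = 0 := by
  obtain ⟨r, h₀, h₁⟩ := exists_double_root_of_sq_dvd hA hl hl₁ hdvd
  have hdet : (A.map (Int.castRingHom Qbar)).det ≠ 0 := by
    rw [← RingHom.mapMatrix_apply, ← RingHom.map_det]
    simpa using hA
  have h := pencilDisc_eq_zero_of_double_root hdet h₀ h₁
  rw [← map_pencilDisc] at h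
  have h' : pencilDisc A (symMatrix x) = 0 := by simpa using h
  have := eval₂_pencilDiscPoly A x
  simpa [eval₂_id, h'] using this

/-- There is an absolute constant `C` such that for every symmetric integer `5×5` matrix
`A` with `det A ≠ 0` and every `P ≥ 1`, the number of symmetric integer matrices `B` with
entries bounded by `P` such that `f(λ,μ) = det(λA + μB)` is not separable over `ℚ̄`
(i.e. is divisible by the square of a nonzero linear form) is at most `C · P^14`. -/
theorem frequency_not_separable :
    ∃ C : ℝ, 0 < C ∧ ∀ A : Matrix (Fin 5) (Fin 5) ℤ, A.IsSymm → A.det ≠ 0 →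
      ∀ P : ℝ, 1 ≤ P →
        (Nat.card {B : Matrix (Fin 5) (Fin 5) ℤ //
            B.IsSymm ∧ (∀ i j : Fin 5, (|B i j| : ℝ) ≤ P) ∧
            ∃ ℓ : MvPolynomial (Fin 2) Qbar,
              ℓ ≠ 0 ∧ ℓ.IsHomogeneous 1 ∧ ℓ ^ 2 ∣ charFormQbar A B} : ℝ)
          ≤ C * P ^ (14 : ℕ) := by
  refine ⟨genericPencilDisc.totalDegree * 3 ^ 14 + 1, by positivity, fun A hA hdet P hP => ?_⟩
  let S : Finset ℤ := Finset.Icc (-⌊P⌋) ⌊P⌋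
  have hfl : 1 ≤ ⌊P⌋ := Int.le_floor.2 (by simpa using hP)
  have hS : (S.card : ℝ) ≤ 3 * P := by
    have h : (S.card : ℤ) = 2 * ⌊P⌋ + 1 := by
      rw [Int.card_Icc, Int.toNat_of_nonneg] <;> omega
    have h' : (S.card : ℝ) = 2 * ⌊P⌋ + 1 := by exact_mod_cast h
    linarith [Int.floor_le P]
  let Z : Finset (Fin 15 → ℤ) :=
    {x ∈ Fintype.piFinset fun _ => S | eval x (pencilDiscPoly A) = 0}
  have hZ : Z.card ≤ genericPencilDisc.totalDegree * S.card ^ 14 :=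
    (card_zeros_le (pencilDiscPoly_ne_zero hA hdet) S ⟨0, by simp [S]; omega⟩).trans
      (Nat.mul_le_mul_right _ (Finset.sup_mono (support_map_subset _ _)))
  have hcard : Nat.card {B : Matrix (Fin 5) (Fin 5) ℤ //
      B.IsSymm ∧ (∀ i j : Fin 5, (|B i j| : ℝ) ≤ P) ∧
      ∃ ℓ : MvPolynomial (Fin 2) Qbar,
        ℓ ≠ 0 ∧ ℓ.IsHomogeneous 1 ∧ ℓ ^ 2 ∣ charFormQbar A B} ≤ Z.card := by
    classical
    refine le_trans ?_ (Finset.card_image_le (s := Z) (f := symMatrix))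
    rw [← Nat.card_eq_finsetCard]
    refine Nat.card_mono (Finset.finite_toSet _) ?_
    rintro B ⟨hB, hbd, l, hl, hl₁, hdvd⟩
    obtain ⟨x, rfl, hx⟩ := exists_eq_symMatrix hB
    refine Finset.mem_coe.2 (Finset.mem_image_of_mem _ (Finset.mem_filter.2
      ⟨Fintype.mem_piFinset.2 fun k => ?_, eval_pencilDiscPoly_eq_zero hdet hl hl₁ hdvd⟩))
    obtain ⟨i, j, hij⟩ := hx k
    have h := hbd i j
    rw [← hij] at h
    exact Finset.mem_Icc.2 (abs_le.1 (Int.le_floor.2 (by exact_mod_cast h)))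
  have hZ' : (Z.card : ℝ) ≤ genericPencilDisc.totalDegree * (S.card : ℝ) ^ 14 := by
    rw [← Nat.cast_pow, ← Nat.cast_mul]
    exact Nat.cast_le.2 hZ
  calc _ ≤ (Z.card : ℝ) := Nat.cast_le.2 hcard
    _ ≤ genericPencilDisc.totalDegree * (S.card : ℝ) ^ 14 := hZ'
    _ ≤ genericPencilDisc.totalDegree * (3 * P) ^ 14 :=
      mul_le_mul_of_nonneg_left (pow_le_pow_left₀ (Nat.cast_nonneg _) hS 14) (Nat.cast_nonneg _)
    _ = genericPencilDisc.totalDegree * 3 ^ 14 * P ^ 14 := by ring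
    _ ≤ (genericPencilDisc.totalDegree * 3 ^ 14 + 1) * P ^ 14 := by
      gcongr
      exact le_add_of_nonneg_right zero_le_one
end
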